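/- Let a > 0 and b > 0 be real numbers, let (η_t)_{t≥0} be a nonincreasing sequence of positive reals, and let (z_t)_{t≥0} be a sequence of nonnegative reals satisfying z_{t+1} ≤ (1 − a·η_t)·z_t + η_t·b for all t ≥ 0. Then for every t ≥ 0, z_t ≤ max{ b/a, z_0, η_0·b }. -/

import Mathlib

/-- Let `a, b > 0`, let `η` be a nonincreasing sequence of positive reals and `z` a
sequence of nonnegative reals with `z (t+1) ≤ (1 − a·η t)·z t + η t·b` for all `t`.
Then `z t ≤ max {b/a, z 0, η 0 · b}` for every `t`. -/
theorem stmt_4 (a b : ℝ) (ha : 0 < a) (hb : 0 < b) (η z : ℕ → ℝ)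
    (hη_pos : ∀ t, 0 < η t) (hη_anti : Antitone η)
    (hz_nonneg : ∀ t, 0 ≤ z t)
    (hrec : ∀ t, z (t + 1) ≤ (1 - a * η t) * z t + η t * b) :
    ∀ t, z t ≤ max (b / a) (max (z 0) (η 0 * b)) := by
  set M := max (b / a) (max (z 0) (η 0 * b))
  have hbM : b ≤ M * a := (div_le_iff₀ ha).1 (le_max_left _ _)
  have hzM : z 0 ≤ M := (le_max_left _ _).trans (le_max_right _ _)
  have hηM : η 0 * b ≤ M := (le_max_right _ _).trans (le_max_right _ _)
  intro t
  induction t with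
  | zero => exact hzM
  | succ t ih =>
    refine (hrec t).trans ?_
    rcases le_total 0 (1 - a * η t) with h | h
    · have h₁ := mul_le_mul_of_nonneg_left ih h
      have h₂ := mul_le_mul_of_nonneg_left hbM (hη_pos t).le
      linarith
    · have h₁ := mul_nonpos_of_nonpos_of_nonneg h (hz_nonneg t)
      have h₂ := mul_le_mul_of_nonneg_right (hη_anti (Nat.zero_le t)) hb.le
      linarith
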